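/- arXiv:1408.5194 — 2 statements merged into one kernel-verified Lean document; each statement's English description precedes it below -/
import Mathlib

section
/- Let ℓ be a prime and let K be a function field over an algebraically closed field k with char k ≠ ℓ. For any two relatively algebraically closed subextensions L_1, L_2 of K|k, one has L_1 ⊆ L_2 if and only if Ω_K(L_1) ⊆ Ω_K(L_2). In particular Ω_K(L_1) = Ω_K(L_2) implies L_1 = L_2, so the map L ↦ Ω_K(L) is an order isomorphism from the poset (under inclusion) of relatively algebraically closed subextensions of K|k onto its image in the lattice of subgroups of K^×/(K^×)^ℓ. -/
/-! Common definitions: mod-ℓ Milnor K-theory, K^×/(K^×)^ℓ, Ω_K, relative algebraic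
closure, transcendence degree predicates, discrete valuations, etc. -/

noncomputable section

open scoped TensorProduct

universe u v

/-- The `n`-fold tensor power (over `ℤ`) of the multiplicative group `Kˣ`,
written additively. -/
abbrev MilnorPre (n : ℕ) (K : Type*) [Field K] : Type _ :=
  PiTensorProduct ℤ (fun _ : Fin n => Additive Kˣ)

/-- The submodule of Steinberg relations: generated by all `a₁ ⊗ ⋯ ⊗ aₙ`
with `aᵢ + aⱼ = 1` for some `i < j`. -/
def SteinbergRel (n : ℕ) (K : Type*) [Field K] : Submodule ℤ (MilnorPre n K) :=
  Submodule.span ℤ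
    {x | ∃ a : Fin n → Kˣ,
      (∃ i j : Fin n, i < j ∧ ((a i : K) + (a j : K) = 1)) ∧
        x = PiTensorProduct.tprod ℤ (fun i => Additive.ofMul (a i))}

/-- The `n`-th Milnor K-group `K^M_n(K)`: the quotient of the `n`-fold tensor
power of `K^×` by the Steinberg relations. -/
abbrev MilnorK (n : ℕ) (K : Type*) [Field K] : Type _ :=
  MilnorPre n K ⧸ SteinbergRel n K

/-- The mod-`ℓ` Milnor K-group `k^M_n(K) = K^M_n(K)/ℓ`. -/
abbrev MilnorKMod (ℓ n : ℕ) (K : Type*) [Field K] : Type _ :=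
  MilnorK n K ⧸ LinearMap.range ((ℓ : ℤ) • (LinearMap.id : MilnorK n K →ₗ[ℤ] MilnorK n K))

/-- The symbol `{a₁, …, aₙ}` in `k^M_n(K)`. -/
def milnorSymbol (ℓ : ℕ) {n : ℕ} {K : Type*} [Field K] (a : Fin n → Kˣ) :
    MilnorKMod ℓ n K :=
  Submodule.Quotient.mk (Submodule.Quotient.mk
    (PiTensorProduct.tprod ℤ (fun i => Additive.ofMul (a i))))

/-- `k^M_1(K) = K^×/(K^×)^ℓ`, written multiplicatively. -/
abbrev K1 (ℓ : ℕ) (K : Type*) [Field K] : Type _ :=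
  Kˣ ⧸ (powMonoidHom ℓ : Kˣ →* Kˣ).range

/-- The projection `K^× → K^×/(K^×)^ℓ`. -/
def K1proj (ℓ : ℕ) (K : Type*) [Field K] : Kˣ →* K1 ℓ K :=
  QuotientGroup.mk' _

/-- The subgroup of `Kˣ` consisting of the units lying in an intermediate field `L`. -/
def fieldUnits {k K : Type*} [Field k] [Field K] [Algebra k K]
    (L : IntermediateField k K) : Subgroup Kˣ where
  carrier := {x : Kˣ | (x : K) ∈ L}
  one_mem' := by simpa using one_mem L
  mul_mem' := by
    intro a b ha hb
    simpa using mul_mem ha hb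
  inv_mem' := by
    intro a ha
    simpa using inv_mem (show (a : K) ∈ L from ha)

/-- `Ω_K(L)`: the image of `L^×` in `K^×/(K^×)^ℓ`. -/
def Omega (ℓ : ℕ) {k K : Type*} [Field k] [Field K] [Algebra k K]
    (L : IntermediateField k K) : Subgroup (K1 ℓ K) :=
  (fieldUnits L).map (K1proj ℓ K)

/-- A subextension `L` of `K|k` is relatively algebraically closed in `K` if every
element of `K` algebraic over `L` lies in `L`. -/
def RelAlgClosed {k K : Type*} [Field k] [Field K] [Algebra k K]
    (L : IntermediateField k K) : Prop :=
  ∀ x : K, IsAlgebraic L x → x ∈ L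

/-- `K` is a function field over `k`: a finitely generated field extension. -/
def IsFunctionField (k K : Type*) [Field k] [Field K] [Algebra k K] : Prop :=
  ∃ s : Finset K, IntermediateField.adjoin k (s : Set K) = ⊤

/-- `trdeg(K|k) = d`: there is a transcendence basis indexed by `Fin d`. -/
def HasTrdeg (k : Type*) (K : Type*) [Field k] [Field K] [Algebra k K] (d : ℕ) : Prop :=
  ∃ x : Fin d → K, IsTranscendenceBasis k x

/-- `trdeg(K|k) ≥ m`: there are `m` algebraically independent elements. -/
def TrdegGe (k : Type*) (K : Type*) [Field k] [Field K] [Algebra k K] (m : ℕ) : Prop :=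
  ∃ x : Fin m → K, AlgebraicIndependent k x

/-- `dim^M_K(S) ≥ d` for a subset `S ⊆ k^M_1(K)`: there are `s₁, …, s_d ∈ S` with
`{s₁, …, s_d} ≠ 0` in `k^M_d(K)`. -/
def dimMge (ℓ : ℕ) {K : Type*} [Field K] (S : Set (K1 ℓ K)) (d : ℕ) : Prop :=
  ∃ a : Fin d → Kˣ, (∀ i, K1proj ℓ K (a i) ∈ S) ∧ milnorSymbol ℓ a ≠ 0

/-- `dim^M_K(S) = r`. -/
def dimMeq (ℓ : ℕ) {K : Type*} [Field K] (S : Set (K1 ℓ K)) (r : ℕ) : Prop :=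
  dimMge ℓ S r ∧ ¬ dimMge ℓ S (r + 1)

/-- `t` is a general element of `K` over `k`: `t ∉ k` and `k(t)` is relatively
algebraically closed in `K`. -/
def IsGeneralElement (k : Type*) {K : Type*} [Field k] [Field K] [Algebra k K] (t : K) : Prop :=
  t ∉ (⊥ : IntermediateField k K) ∧ RelAlgClosed (IntermediateField.adjoin k {t})

/-- A rational subgroup of `k^M_1(K)`: `Ω_K(k(t))` for a general element `t`. -/
def IsRationalSubgroup (ℓ : ℕ) (k : Type*) {K : Type*} [Field k] [Field K] [Algebra k K]
    (A : Subgroup (K1 ℓ K)) : Prop :=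
  ∃ t : K, IsGeneralElement k t ∧ A = Omega ℓ (IntermediateField.adjoin k {t})

/-- `𝔊^r(K|k)`: the subgroups `Ω_K(L)` for `L` relatively algebraically closed
in `K` of transcendence degree `r` over `k`. -/
def GSet (ℓ : ℕ) (k : Type*) {K : Type*} [Field k] [Field K] [Algebra k K] (r : ℕ) :
    Set (Subgroup (K1 ℓ K)) :=
  {A | ∃ L : IntermediateField k K, RelAlgClosed L ∧ HasTrdeg k L r ∧ A = Omega ℓ L}

/-- `𝔐^1(K)`: subgroups maximal among the subgroups `B` of `k^M_1(K)`
with `dim^M_K(B) = 1`. -/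
def M1Set (ℓ : ℕ) (K : Type*) [Field K] : Set (Subgroup (K1 ℓ K)) :=
  {A | dimMeq ℓ (A : Set (K1 ℓ K)) 1 ∧
    ∀ B : Subgroup (K1 ℓ K), dimMeq ℓ (B : Set (K1 ℓ K)) 1 → A ≤ B → B = A}

/-- Condition (a) and (b) of the maximality characterization of `𝔊^r`:
`B` is generated by rational subgroups and `dim^M_K(B) = r`. -/
def SpannedByRatWithDim (ℓ : ℕ) (k : Type*) {K : Type*} [Field k] [Field K] [Algebra k K]
    (r : ℕ) (B : Subgroup (K1 ℓ K)) : Prop :=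
  (∃ S : Set (Subgroup (K1 ℓ K)), (∀ T ∈ S, IsRationalSubgroup ℓ k T) ∧ B = sSup S) ∧
    dimMeq ℓ (B : Set (K1 ℓ K)) r

/-- A discrete valuation of a field `F`: a surjective homomorphism `F^× → ℤ`
satisfying the ultrametric inequality. -/
structure DiscreteValuation (F : Type*) [Field F] where
  v : Fˣ → ℤ
  map_mul' : ∀ x y : Fˣ, v (x * y) = v x + v y
  surjective' : Function.Surjective v
  min_le' : ∀ x y z : Fˣ, (x : F) + (y : F) = (z : F) → min (v x) (v y) ≤ v z

lemma DiscreteValuation.v_one {F : Type*} [Field F] (w : DiscreteValuation F) : w.v 1 = 0 := by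
  have h := w.map_mul' 1 1
  simp only [mul_one] at h
  omega

/-- A discrete valuation of `F` is trivial on the base field `k`. -/
def DiscreteValuation.TrivialOn (k : Type*) {F : Type*} [Field k] [Field F] [Algebra k F]
    (w : DiscreteValuation F) : Prop :=
  ∀ (c : k) (hc : algebraMap k F c ≠ 0), w.v (Units.mk0 _ hc) = 0

/-- The unit group `U_w ⊆ F^×` of a discrete valuation. -/
def DiscreteValuation.units {F : Type*} [Field F] (w : DiscreteValuation F) : Subgroup Fˣ where
  carrier := {x : Fˣ | w.v x = 0}
  one_mem' := w.v_one
  mul_mem' := by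
    intro a b ha hb
    have h := w.map_mul' a b
    simp only [Set.mem_setOf_eq] at ha hb ⊢
    omega
  inv_mem' := by
    intro a ha
    have h := w.map_mul' a a⁻¹
    rw [mul_inv_cancel] at h
    have h1 := w.v_one
    simp only [Set.mem_setOf_eq] at ha ⊢
    omega

/-- `𝔘_v`: the image of the unit group `U_v` in `K^×/(K^×)^ℓ`. -/
def DiscreteValuation.unitsImage (ℓ : ℕ) {F : Type*} [Field F] (w : DiscreteValuation F) :
    Subgroup (K1 ℓ F) :=
  w.units.map (K1proj ℓ F)

/-- For a discrete valuation `w` of an intermediate field `F` of `K|k`, the image of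
the unit group `U_w` in `K^×/(K^×)^ℓ`. -/
def unitsImageIn (ℓ : ℕ) {k K : Type*} [Field k] [Field K] [Algebra k K]
    (F : IntermediateField k K) (w : DiscreteValuation F) : Subgroup (K1 ℓ K) :=
  (w.units.map (Units.map (algebraMap F K).toMonoidHom)).map (K1proj ℓ K)

/-- The residue field of `v` has transcendence degree `≥ m` over `k`: there are
`v`-units `x₁, …, x_m` whose residues are algebraically independent over `k`,
expressed by saying that every nonzero polynomial over `k` evaluated at the `xᵢ`
is a unit of value `0`. -/
def DiscreteValuation.ResidueTrdegGe (k : Type*) {K : Type*} [Field k] [Field K] [Algebra k K]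
    (v : DiscreteValuation K) (m : ℕ) : Prop :=
  ∃ x : Fin m → Kˣ, (∀ i, v.v (x i) = 0) ∧
    ∀ P : MvPolynomial (Fin m) k, P ≠ 0 →
      ∃ u : Kˣ, (u : K) = MvPolynomial.aeval (fun i => ((x i : K))) P ∧ v.v u = 0

/-- A divisorial-type valuation of `K|k` (where `d = trdeg(K|k)`): a discrete valuation
trivial on `k` whose residue field has transcendence degree exactly `d - 1` over `k`. -/
def IsDivisorialType (k : Type*) {K : Type*} [Field k] [Field K] [Algebra k K] (d : ℕ)
    (v : DiscreteValuation K) : Prop :=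
  v.TrivialOn k ∧ v.ResidueTrdegGe k (d - 1) ∧ ¬ v.ResidueTrdegGe k d

/-- `Δ_A`: the set of subgroups `A ⊓ 𝔘_v`, for `v` ranging over the divisorial-type
valuations of `K` with `A ⊄ 𝔘_v`. -/
def DeltaA (ℓ : ℕ) (k : Type*) {K : Type*} [Field k] [Field K] [Algebra k K] (d : ℕ)
    (A : Subgroup (K1 ℓ K)) : Set (Subgroup (K1 ℓ K)) :=
  {T | ∃ v : DiscreteValuation K, IsDivisorialType k d v ∧
    ¬ A ≤ v.unitsImage ℓ ∧ T = A ⊓ v.unitsImage ℓ}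

/-- A good rational subgroup: a rational subgroup `A = Ω_K(k(t))` such that for every
discrete valuation `w` of `k(t)` trivial on `k`, the image of `U_w` in `K^×/(K^×)^ℓ`
belongs to `Δ_A`. -/
def IsGoodRationalSubgroup (ℓ : ℕ) (k : Type*) {K : Type*} [Field k] [Field K] [Algebra k K]
    (d : ℕ) (A : Subgroup (K1 ℓ K)) : Prop :=
  ∃ t : K, IsGeneralElement k t ∧ A = Omega ℓ (IntermediateField.adjoin k {t}) ∧
    ∀ w : DiscreteValuation (IntermediateField.adjoin k {t}), w.TrivialOn k →
      unitsImageIn ℓ (IntermediateField.adjoin k {t}) w ∈ DeltaA ℓ k d A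

/-- A very general element: a general element `t` such that `Ω_K(k(t))` is a good
rational subgroup. -/
def IsVeryGeneral (ℓ : ℕ) (k : Type*) {K : Type*} [Field k] [Field K] [Algebra k K]
    (d : ℕ) (t : K) : Prop :=
  IsGeneralElement k t ∧ IsGoodRationalSubgroup ℓ k d (Omega ℓ (IntermediateField.adjoin k {t}))

/-- `x` is separable in `K`: in characteristic `p > 0`, `x` is not a `p`-th power;
in characteristic `0` every element is separable. -/
def IsSeparableIn (K : Type*) [Field K] (x : K) : Prop :=
  ∀ p : ℕ, p.Prime → CharP K p → ¬ ∃ y : K, y ^ p = x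

/-- A perfect closure of `K`: a perfect field which is a purely inseparable
extension of `K`. -/
structure PerfectClosureOf (K : Type u) [Field K] : Type (u + 1) where
  carrier : Type u
  [fieldInst : Field carrier]
  [algebraInst : Algebra K carrier]
  purelyInseparable : IsPurelyInseparable K carrier
  perfect : PerfectField carrier

attribute [instance] PerfectClosureOf.fieldInst PerfectClosureOf.algebraInst

/-- A group isomorphism `φ : k^M_1(K) → k^M_1(L)` is induced by a field isomorphism
`σ : K^i → L^i` of the perfect closures, via the canonical identifications
`k^M_1(K) ≅ k^M_1(K^i)` and `k^M_1(L) ≅ k^M_1(L^i)`. -/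
def InducesOnK1 (ℓ : ℕ) {K : Type u} {L : Type v} [Field K] [Field L]
    (PK : PerfectClosureOf K) (PL : PerfectClosureOf L)
    (σ : PK.carrier ≃+* PL.carrier) (φ : K1 ℓ K ≃* K1 ℓ L) : Prop :=
  ∀ (x : Kˣ) (y : Lˣ),
    (φ (K1proj ℓ K x) = K1proj ℓ L y ↔
      ∃ z : (PL.carrier)ˣ,
        Units.map σ.toRingHom.toMonoidHom
            (Units.map (algebraMap K PK.carrier).toMonoidHom x) =
          Units.map (algebraMap L PL.carrier).toMonoidHom y * z ^ ℓ)

/-- `φ : k^M_1(K) → k^M_1(L)` is compatible with `k^M_2`: `φ ⊗ φ` descends, along the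
multiplication maps, to an isomorphism `k^M_2(K) → k^M_2(L)`; equivalently, there is an
additive isomorphism `k^M_2(K) ≃ k^M_2(L)` carrying `{a, b}` to `{a', b'}` whenever
`φ` carries the class of `a` (resp. `b`) to the class of `a'` (resp. `b'`). -/
def CompatWithK2 (ℓ : ℕ) {K L : Type*} [Field K] [Field L] (φ : K1 ℓ K ≃* K1 ℓ L) : Prop :=
  ∃ ψ : MilnorKMod ℓ 2 K ≃+ MilnorKMod ℓ 2 L,
    ∀ (a b : Kˣ) (a' b' : Lˣ),
      φ (K1proj ℓ K a) = K1proj ℓ L a' → φ (K1proj ℓ K b) = K1proj ℓ L b' →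
        ψ (milnorSymbol ℓ ![a, b]) = milnorSymbol ℓ ![a', b']

/-- `φ : k^M_1(K) → k^M_1(L)` is compatible with `𝔊^1_rat`: it maps rational subgroups
bijectively onto rational subgroups. -/
def CompatWithRat (ℓ : ℕ) (k : Type*) (l : Type*) {K L : Type*}
    [Field k] [Field K] [Algebra k K] [Field l] [Field L] [Algebra l L]
    (φ : K1 ℓ K ≃* K1 ℓ L) : Prop :=
  (∀ A : Subgroup (K1 ℓ K), IsRationalSubgroup ℓ k A →
     IsRationalSubgroup ℓ l (A.map φ.toMonoidHom)) ∧
  (∀ B : Subgroup (K1 ℓ L), IsRationalSubgroup ℓ l B →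
     ∃ A : Subgroup (K1 ℓ K), IsRationalSubgroup ℓ k A ∧ A.map φ.toMonoidHom = B)

/-- Two isomorphisms of perfect closures differ by a power of the Frobenius
(in characteristic `0`, they are equal). -/
def FrobTwistEquiv {Ki Li : Type*} [Field Ki] [Field Li] (σ σ' : Ki ≃+* Li) : Prop :=
  σ = σ' ∨ ∃ p : ℕ, p.Prime ∧ CharP Ki p ∧
    ((∃ n : ℕ, ∀ x, σ' x = σ (x ^ p ^ n)) ∨ (∃ n : ℕ, ∀ x, σ x = σ' (x ^ p ^ n)))

/-- A radical `w` (that is, `w ^ n ∈ M`) over a field `M` containing a primitive `n`-th root of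
unity lies in `M` as soon as it is fixed by all automorphisms of a normal extension. -/
theorem mem_range_algebraMap_of_pow_mem_of_fixed {M N : Type*} [Field M] [Field N] [Algebra M N]
    [Normal M N] {n : ℕ} [NeZero n] {ζ : M} (hζ : IsPrimitiveRoot ζ n) {w : N}
    (hw : w ^ n ∈ Set.range (algebraMap M N)) (hfix : ∀ σ : Gal(N/M), σ w = w) :
    w ∈ Set.range (algebraMap M N) := by
  obtain ⟨c, hc⟩ := hw
  by_cases hw0 : w = 0
  · exact ⟨0, by simp [hw0]⟩
  have hc0 : c ≠ 0 := by
    rintro rfl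
    exact hw0 (pow_eq_zero_iff (NeZero.ne n) |>.mp (by rw [← hc, map_zero]))
  have hn : (n : M) ≠ 0 := hζ.neZero'.ne
  have hsep : IsSeparable M w :=
    (Polynomial.separable_X_pow_sub_C c hn hc0).of_dvd (minpoly.dvd M w (by simp [hc]))
  by_contra hmem
  have hbot : w ∉ (⊥ : Subalgebra M N) := by rwa [Algebra.mem_bot]
  obtain ⟨y, hne, hy⟩ :=
    (notMem_iff_exists_ne_and_isConjRoot hsep (Normal.splits inferInstance w)).mp hbot
  obtain ⟨σ, hσ⟩ := isConjRoot_iff_exists_algEquiv.mp hy.symm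
  exact hne (by rw [← hσ, hfix σ])

/-- Radicals with pairwise quotients outside of a base field containing the roots of unity are
linearly independent: the case of a normal extension. -/
theorem linearIndependent_radicals_of_normal {M N ι : Type*} [Field M] [Field N] [Algebra M N]
    [Normal M N] {n : ℕ} [NeZero n] {ζ : M} (hζ : IsPrimitiveRoot ζ n) {u : ι → N}
    (hu0 : ∀ i, u i ≠ 0) (hu : ∀ i, u i ^ n ∈ Set.range (algebraMap M N))
    (hne : ∀ i j, i ≠ j → u i / u j ∉ Set.range (algebraMap M N)) :
    LinearIndependent M u := by
  have hζ' := hζ.map_of_injective (algebraMap M N).injective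
  have hfix (i : ι) (σ τ : Gal(N/M)) : σ (τ (u i) / u i) = τ (u i) / u i := by
    have hpow : (τ (u i) / u i) ^ n = 1 := by
      obtain ⟨c, hc⟩ := hu i
      rw [div_pow, ← map_pow, ← hc, AlgEquiv.commutes, hc, div_self (pow_ne_zero _ (hu0 i))]
    obtain ⟨m, -, hm⟩ := hζ'.eq_pow_of_pow_eq_one hpow
    rw [← hm, ← map_pow, AlgEquiv.commutes]
  let χ (i : ι) : Gal(N/M) →* N :=
    { toFun σ := σ (u i) / u i
      map_one' := by simp [hu0 i]
      map_mul' σ τ := by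
        have h := hfix i σ τ
        rw [map_div₀, div_eq_iff (by simpa using hu0 i)] at h
        rw [AlgEquiv.mul_apply, h, mul_div_assoc, mul_comm] }
  have hχ : Function.Injective χ := by
    intro i j hij
    by_contra hij'
    refine hne i j hij' (mem_range_algebraMap_of_pow_mem_of_fixed hζ ?_ fun σ ↦ ?_)
    · obtain ⟨c, hc⟩ := hu i
      obtain ⟨d, hd⟩ := hu j
      exact ⟨c / d, by rw [map_div₀, hc, hd, div_pow]⟩
    · have h : σ (u i) / u i = σ (u j) / u j := DFunLike.congr_fun hij σ
      have hj : σ (u j) ≠ 0 := by simpa using hu0 j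
      rw [div_eq_div_iff (hu0 i) (hu0 j)] at h
      rw [map_div₀, div_eq_div_iff hj (hu0 j), h, mul_comm]
  have hli := (linearIndependent_monoidHom Gal(N/M) N).comp χ hχ
  rw [linearIndependent_iff'] at hli ⊢
  intro s g hg i hi
  have h := hli s (fun i ↦ algebraMap M N (g i) * u i) ?_ i hi
  · simpa [hu0 i] using h
  · funext σ
    have := congrArg σ hg
    simp only [map_sum, map_smul, map_zero] at this
    rw [Finset.sum_apply, Pi.zero_apply, ← this]
    refine Finset.sum_congr rfl fun i _ ↦ ?_
    simp only [Function.comp_apply, Pi.smul_apply, smul_eq_mul, Algebra.smul_def]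
    change _ * (σ (u i) / u i) = _
    field_simp [hu0 i]

/-- Radicals with pairwise quotients outside of a base field containing the roots of unity are
linearly independent. -/
theorem linearIndependent_radicals {M K ι : Type*} [Field M] [Field K] [Algebra M K]
    [Algebra.IsAlgebraic M K] {n : ℕ} [NeZero n] {ζ : M} (hζ : IsPrimitiveRoot ζ n) {u : ι → K}
    (hu0 : ∀ i, u i ≠ 0) (hu : ∀ i, u i ^ n ∈ Set.range (algebraMap M K))
    (hne : ∀ i j, i ≠ j → u i / u j ∉ Set.range (algebraMap M K)) :
    LinearIndependent M u := by
  have : Algebra.IsAlgebraic M (AlgebraicClosure K) := Algebra.IsAlgebraic.trans M K _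
  have : IsAlgClosure M (AlgebraicClosure K) := ⟨inferInstance, inferInstance⟩
  have : Normal M (AlgebraicClosure K) := IsAlgClosure.normal M _
  have hinj := (algebraMap K (AlgebraicClosure K)).injective
  have hmem (x : K) : algebraMap K (AlgebraicClosure K) x ∈
      Set.range (algebraMap M (AlgebraicClosure K)) ↔ x ∈ Set.range (algebraMap M K) := by
    simp only [Set.mem_range, IsScalarTower.algebraMap_apply M K (AlgebraicClosure K), hinj.eq_iff]
  have h := linearIndependent_radicals_of_normal (M := M) hζ
    (u := fun i ↦ algebraMap K (AlgebraicClosure K) (u i))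
    (fun i ↦ by simpa using hu0 i)
    (fun i ↦ by rw [← map_pow, hmem]; exact hu i)
    (fun i j hij ↦ by rw [← map_div₀, hmem]; exact hne i j hij)
  exact h.of_comp (IsScalarTower.toAlgHom M K (AlgebraicClosure K)).toLinearMap

open Polynomial in
/-- The order of vanishing at `a` shows that `(X - a) / (X - b)` is not the product of a constant
and an `n`-th power of a rational function. -/
theorem X_sub_C_mul_pow_ne {F : Type*} [Field F] {n : ℕ} (hn : 1 < n) {a b c d : F} (hab : a ≠ b)
    (hc : c ≠ 0) (hd : d ≠ 0) {p q : F[X]} (hp : p ≠ 0) (hq : q ≠ 0) :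
    (X - C a) * C c * q ^ n ≠ (X - C b) * C d * p ^ n := by
  intro h
  classical
  have h' := congrArg (rootMultiplicity a) h
  have hroot : ¬ IsRoot (X - C b) a := by simpa [sub_eq_zero] using hab
  have hq' : (X - C a) * C c * q ^ n ≠ 0 := by simp [X_sub_C_ne_zero, hc, hq]
  have hp' : (X - C b) * C d * p ^ n ≠ 0 := by simp [X_sub_C_ne_zero, hd, hp]
  rw [rootMultiplicity_mul hq', rootMultiplicity_mul (left_ne_zero_of_mul hq'),
    rootMultiplicity_mul hp', rootMultiplicity_mul (left_ne_zero_of_mul hp'),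
    rootMultiplicity_X_sub_C_self, rootMultiplicity_C, rootMultiplicity_C,
    rootMultiplicity_eq_zero hroot, ← count_roots (q ^ n), ← count_roots (p ^ n), roots_pow,
    roots_pow, Multiset.count_nsmul, Multiset.count_nsmul] at h'
  have hdvd : n ∣ 1 := (Nat.dvd_add_left (dvd_mul_right n _)).mp
    ⟨p.roots.count a, by simpa using h'⟩
  exact hn.ne' (Nat.dvd_one.mp hdvd)

/-- If `K` is finite over a rational function field `F(x)`, it is impossible that the elements
`x - a`, for infinitely many constants `a`, all become constants modulo `n`-th powers in `K`. -/
theorem exists_sub_ne_mul_pow {F K ι : Type*} [Field F] [Field K] [Algebra F K] [Infinite ι]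
    {x : K} (hx : Transcendental F x) [FiniteDimensional (IntermediateField.adjoin F {x}) K]
    {n : ℕ} (hn : 1 < n) {ζ : F} (hζ : IsPrimitiveRoot ζ n) {a : ι → F}
    (ha : Function.Injective a) :
    ∃ i, ∀ (y : F) (z : K), x - algebraMap F K (a i) ≠ algebraMap F K y * z ^ n := by
  by_contra! hyz
  choose y z hyz using hyz
  have : NeZero n := ⟨by omega⟩
  let M := IntermediateField.adjoin F {x}
  have hxM : x ∈ M := IntermediateField.mem_adjoin_simple_self F x
  have hinj : Function.Injective (Polynomial.aeval (R := F) x) :=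
    transcendental_iff_injective.mp hx
  have hxa (i : ι) : x - algebraMap F K (a i) ≠ 0 := by
    have := (map_ne_zero_iff _ hinj).mpr (Polynomial.X_sub_C_ne_zero (a i))
    simpa using this
  have hy0 (i : ι) : y i ≠ 0 := fun h ↦ hxa i (by simp [hyz, h])
  have hz0 (i : ι) : z i ≠ 0 := fun h ↦ hxa i (by simp [hyz, h, NeZero.ne n])
  have hy0' (i : ι) : algebraMap F K (y i) ≠ 0 := by simpa using hy0 i
  have hli : LinearIndependent M z := by
    refine linearIndependent_radicals (hζ.map_of_injective (algebraMap F M).injective) hz0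
      (fun i ↦ ⟨⟨(x - algebraMap F K (a i)) / algebraMap F K (y i),
        div_mem (sub_mem hxM (M.algebraMap_mem _)) (M.algebraMap_mem _)⟩, ?_⟩) fun i j hij ↦ ?_
    · change (x - algebraMap F K (a i)) / algebraMap F K (y i) = _
      rw [hyz, mul_div_cancel_left₀ _ (hy0' i)]
    · rintro ⟨r, hr⟩
      obtain ⟨p, q, hpq⟩ := (IntermediateField.mem_adjoin_simple_iff F _).mp r.2
      replace hr : z i / z j = Polynomial.aeval x p / Polynomial.aeval x q := by
        rw [← hpq, ← hr]; rfl
      have hpq0 : Polynomial.aeval x p / Polynomial.aeval x q ≠ 0 := by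
        rw [← hr]; exact div_ne_zero (hz0 i) (hz0 j)
      obtain ⟨hp0, hq0⟩ := div_ne_zero_iff.mp hpq0
      have hp : p ≠ 0 := by rintro rfl; simp at hp0
      have hq : q ≠ 0 := by rintro rfl; simp at hq0
      refine X_sub_C_mul_pow_ne hn (ha.ne hij) (hy0 j) (hy0 i) hp hq (hinj ?_)
      rw [div_eq_div_iff (hz0 j) hq0] at hr
      have hr' := congrArg (· ^ n) hr
      simp only [mul_pow] at hr'
      simp only [map_mul, map_sub, map_pow, Polynomial.aeval_X, Polynomial.aeval_C, hyz]
      linear_combination (algebraMap F K (y i)) * (algebraMap F K (y j)) * hr'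
  have := hli.finite
  exact not_finite ι

open scoped IntermediateField.algebraAdjoinAdjoin in
/-- A transcendental element `x` of `K` over `F` remains transcendental over some intermediate
field `E` with `K` algebraic over `E(x)`. -/
theorem exists_transcendental_isAlgebraic_adjoin {F K : Type*} [Field F] [Field K] [Algebra F K]
    {x : K} (hx : Transcendental F x) :
    ∃ E : IntermediateField F K, Transcendental E x ∧
      Algebra.IsAlgebraic (IntermediateField.adjoin E {x}) K := by
  have hx' : AlgebraicIndepOn F id {x} := by
    rw [AlgebraicIndepOn, algebraicIndependent_singleton_iff (⟨x, rfl⟩ : ({x} : Set K))]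
    exact hx
  obtain ⟨s, hxs, hs⟩ := exists_isTranscendenceBasis_superset hx'
  rw [Set.singleton_subset_iff] at hxs
  have hins : insert x (s \ {x}) = s := by simp [Set.insert_eq_of_mem hxs]
  refine ⟨IntermediateField.adjoin F (s \ {x}), ?_, ?_⟩
  · have h : AlgebraicIndepOn F id (insert x (s \ {x})) := by rw [hins]; exact hs.1
    have h' := ((AlgebraicIndepOn.insert_iff (by simp)).mp h).2
    rw [Set.image_id] at h'
    exact fun hal ↦ h' ((IsFractionRing.isAlgebraic_iff (Algebra.adjoin F (s \ {x}))
      (IntermediateField.adjoin F (s \ {x})) K).mpr hal)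
  · have h := hs.isAlgebraic_field
    rw [Subtype.range_coe] at h
    have heq : (IntermediateField.adjoin (IntermediateField.adjoin F (s \ {x}))
        {x}).restrictScalars F = IntermediateField.adjoin F s := by
      rw [IntermediateField.adjoin_adjoin_left, Set.union_singleton, hins]
    rw [← heq] at h
    exact h

theorem Omega_mono (ℓ : ℕ) {k K : Type*} [Field k] [Field K] [Algebra k K]
    {L₁ L₂ : IntermediateField k K} (h : L₁ ≤ L₂) : Omega ℓ L₁ ≤ Omega ℓ L₂ :=
  Subgroup.map_mono fun _ hx ↦ h hx

/-- If `Ω_K(L₁) ≤ Ω_K(L₂)`, then every element of `L₁` is an element of `L₂` up to an `ℓ`-th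
power in `K`. -/
theorem exists_eq_mul_pow_of_Omega_le {ℓ : ℕ} {k K : Type*} [Field k] [Field K] [Algebra k K]
    {L₁ L₂ : IntermediateField k K} (h : Omega ℓ L₁ ≤ Omega ℓ L₂) {x : K} (hx : x ∈ L₁) :
    ∃ y ∈ L₂, ∃ z : K, x = y * z ^ ℓ := by
  by_cases hx0 : x = 0
  · exact ⟨0, zero_mem _, 0, by simp [hx0]⟩
  obtain ⟨y, hy, hxy⟩ := h ⟨Units.mk0 x hx0, hx, rfl⟩
  obtain ⟨z, hz⟩ := QuotientGroup.eq.mp hxy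
  refine ⟨y, hy, z, ?_⟩
  have h' := congrArg (fun u : Kˣ ↦ (y : K) * u) hz
  simpa using h'.symm

theorem le_of_Omega_le {ℓ : ℕ} (hℓ : ℓ.Prime) {k K : Type*} [Field k] [Field K] [Algebra k K]
    [IsAlgClosed k] (hchar : ringChar k ≠ ℓ) (hK : IsFunctionField k K)
    {L₁ L₂ : IntermediateField k K} (h₂ : RelAlgClosed L₂) (h : Omega ℓ L₁ ≤ Omega ℓ L₂) :
    L₁ ≤ L₂ := by
  intro x hx₁
  by_contra hx₂
  have hx : Transcendental L₂ x := fun hal ↦ hx₂ (h₂ x hal)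
  obtain ⟨E, hxE, halg⟩ := exists_transcendental_isAlgebraic_adjoin hx
  have : Infinite k := IsAlgClosed.instInfinite
  have : NeZero (ℓ : k) := ⟨fun h0 ↦ by
    rcases (Nat.dvd_prime hℓ).mp ((ringChar.spec k ℓ).mp h0) with h1 | h1
    · exact CharP.ringChar_ne_one h1
    · exact hchar h1⟩
  obtain ⟨ζ, hζ⟩ := HasEnoughRootsOfUnity.exists_primitiveRoot k ℓ
  have : FiniteDimensional (IntermediateField.adjoin E {x}) K := by
    obtain ⟨s, hs⟩ := hK
    have htop : IntermediateField.adjoin (IntermediateField.adjoin E {x}) (s : Set K) = ⊤ :=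
      IntermediateField.adjoin_eq_top_of_adjoin_eq_top E <|
        IntermediateField.adjoin_eq_top_of_adjoin_eq_top L₂ <|
          IntermediateField.adjoin_eq_top_of_adjoin_eq_top k hs
    have hfin := IntermediateField.finiteDimensional_adjoin
      (K := IntermediateField.adjoin E {x}) (S := (s : Set K))
      fun y _ ↦ Algebra.IsIntegral.isIntegral y
    rw [htop] at hfin
    exact Module.Finite.equiv IntermediateField.topEquiv.toLinearEquiv
  obtain ⟨a, ha⟩ := exists_sub_ne_mul_pow hxE hℓ.one_lt
    (hζ.map_of_injective (algebraMap k E).injective) (algebraMap k E).injective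
  obtain ⟨y, hy, z, hyz⟩ :=
    exists_eq_mul_pow_of_Omega_le h (sub_mem hx₁ (L₁.algebraMap_mem a))
  exact ha (algebraMap L₂ E ⟨y, hy⟩) z hyz

theorem statement_5 (ℓ : ℕ) (hℓ : ℓ.Prime) (k K : Type*) [Field k] [Field K] [Algebra k K]
    [IsAlgClosed k] (hchar : ringChar k ≠ ℓ) (hK : IsFunctionField k K)
    (L₁ L₂ : IntermediateField k K) (h₁ : RelAlgClosed L₁) (h₂ : RelAlgClosed L₂) :
    (L₁ ≤ L₂ ↔ Omega ℓ L₁ ≤ Omega ℓ L₂) ∧ (Omega ℓ L₁ = Omega ℓ L₂ → L₁ = L₂) := by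
  have key {L L' : IntermediateField k K} (hL' : RelAlgClosed L') :
      L ≤ L' ↔ Omega ℓ L ≤ Omega ℓ L' :=
    ⟨Omega_mono ℓ, le_of_Omega_le hℓ hchar hK hL'⟩
  exact ⟨key h₂, fun h ↦ le_antisymm ((key h₂).mpr h.le) ((key h₁).mpr h.ge)⟩

end
end

section
/- Let K be a function field over an algebraically closed field k and let L be a subextension of K|k with trdeg(L|k) ≥ 2 that is relatively algebraically closed in K. Then every element of L^× is a product of two elements of L, each of which is a general element of K. -/
/-! Common definitions: mod-ℓ Milnor K-theory, K^×/(K^×)^ℓ, Ω_K, relative algebraic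
closure, transcendence degree predicates, discrete valuations, etc. -/

noncomputable section

open scoped TensorProduct

universe u v

section

open IntermediateField Polynomial
open scoped IntermediateField.algebraAdjoinAdjoin

theorem finiteDimensional_algebraicClosure (M K : Type*) [Field M] [Field K] [Algebra M K]
    [Algebra.EssFiniteType M K] : FiniteDimensional M (algebraicClosure M K) := by
  obtain ⟨B, hB⟩ := exists_isTranscendenceBasis M K
  have hBF := hB.1.algebraicClosure
  have : Algebra.IsAlgebraic (adjoin M B) K := by
    have := hB.isAlgebraic_field
    rwa [Subtype.range_coe] at this
  have : Algebra.EssFiniteType (adjoin M B) K := .of_comp M _ K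
  have hfin : FiniteDimensional (adjoin M B) K := Algebra.finite_of_essFiniteType_of_isAlgebraic
  have hadj : ∀ x ∈ Algebra.adjoin M B,
      ∃ P : MvPolynomial B M, MvPolynomial.aeval ((↑) : B → K) P = x := by
    intro x hx
    rwa [← Subtype.range_coe (s := B), Algebra.adjoin_range_eq_range_aeval] at hx
  let b := Module.Basis.ofVectorSpace M (algebraicClosure M K)
  have hli : LinearIndependent (adjoin M B) (fun i => (b i : K)) := by
    rw [← LinearIndependent.iff_fractionRing (Algebra.adjoin M B) (adjoin M B),
      linearIndependent_iff']
    intro s g hg i hi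
    have hP (i) : ∃ P : MvPolynomial B M, MvPolynomial.aeval ((↑) : B → K) P = g i :=
      hadj _ (g i).2
    choose P hP using hP
    have h0 : ∑ i ∈ s, MvPolynomial.C (b i) * (P i).map (algebraMap M (algebraicClosure M K)) =
        0 := by
      apply hBF
      rw [map_zero, ← hg, map_sum]
      refine Finset.sum_congr rfl fun i _ => ?_
      rw [map_mul, MvPolynomial.aeval_map_algebraMap, hP, MvPolynomial.aeval_C, Algebra.smul_def,
        mul_comm]
      rfl
    have hPi : P i = 0 := by
      ext m
      have h1 := congrArg (MvPolynomial.coeff m) h0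
      simp only [MvPolynomial.coeff_sum, MvPolynomial.coeff_C_mul, MvPolynomial.coeff_map,
        MvPolynomial.coeff_zero] at h1
      refine linearIndependent_iff'.1 b.linearIndependent s (fun i => (P i).coeff m) ?_ i hi
      rw [← h1]
      exact Finset.sum_congr rfl fun i _ => by rw [Algebra.smul_def, mul_comm]
    rw [← Subtype.coe_inj, ← hP i, hPi, map_zero]
    rfl
  have := hli.finite
  exact Module.Basis.finiteDimensional_of_finite b

theorem not_mem_adjoin_pow {k K : Type*} [Field k] [Field K] [Algebra k K] {s : K}
    (hs : Transcendental k s) {p : ℕ} (hp : 1 < p) : s ∉ adjoin k {s ^ p} := by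
  intro h
  obtain ⟨a, b, hab⟩ := (mem_adjoin_simple_iff _ _).1 h
  have hb : aeval (s ^ p) b ≠ 0 := fun hb => by
    rw [hb, div_zero] at hab
    exact hs (hab ▸ isAlgebraic_zero)
  rw [eq_div_iff hb] at hab
  have h1 : aeval s (X * expand k p b - expand k p a) = 0 := by
    simp [expand_aeval, hab]
  have h2 : X * expand k p b = expand k p a :=
    sub_eq_zero.1 ((transcendental_iff.1 hs) _ h1)
  have hb0 : b ≠ 0 := by rintro rfl; simp at hb
  have h3 := congrArg natDegree h2
  rw [natDegree_X_mul ((expand_ne_zero (by omega)).2 hb0), natDegree_expand, natDegree_expand] at h3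
  have := congrArg (· % p) h3
  simp [Nat.add_mod, Nat.mod_eq_of_lt hp] at this

theorem mem_adjoin_of_pow_mem_adjoin {k K : Type*} [Field k] [Field K] [Algebra k K] [IsAlgClosed k]
    {p : ℕ} (hp : p.Prime) [CharP K p] {t : K} (ht : Transcendental k t) (htp : ∀ y : K, y ^ p ≠ t)
    {w : K} (hw : w ^ p ∈ adjoin k {t}) : w ∈ adjoin k {t} := by
  have : Fact p.Prime := ⟨hp⟩
  have : CharP k p := (algebraMap k K).charP (algebraMap k K).injective p
  obtain ⟨a, b, hab⟩ := (mem_adjoin_simple_iff _ _).1 hw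
  have hmem (f : k[X]) : aeval t f ∈ adjoin k {t} :=
    algebra_adjoin_le_adjoin _ _ (aeval_mem_adjoin_singleton k t)
  by_cases hb : aeval t b = 0
  · rw [hb, div_zero] at hab
    rw [pow_eq_zero_iff hp.ne_zero] at hab
    exact hab ▸ zero_mem _
  have he : (w * aeval t b) ^ p = aeval t (a * b ^ (p - 1)) := by
    rw [mul_pow, hab, map_mul, map_pow, div_mul_eq_mul_div, mul_div_assoc]
    congr 1
    rw [div_eq_iff hb, ← pow_succ, Nat.sub_add_cancel hp.one_le]
  generalize a * b ^ (p - 1) = Q at he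
  suffices h : w * aeval t b ∈ adjoin k {t} by
    have := div_mem h (hmem b)
    rwa [mul_div_cancel_right₀ _ hb] at this
  generalize w * aeval t b = e at he
  obtain ⟨Q, rfl⟩ : ∃ Q' : k[X], Q'.map (frobenius k p) = Q :=
    Polynomial.map_surjective _ (frobeniusEquiv k p).surjective Q
  have hirr := X_pow_sub_C_irreducible_of_prime hp htp
  have : Fact (Irreducible (X ^ p - C t)) := ⟨hirr⟩
  have : CharP (AdjoinRoot (X ^ p - C t)) p :=
    charP_of_injective_algebraMap (algebraMap K (AdjoinRoot (X ^ p - C t))).injective p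
  set s := AdjoinRoot.root (X ^ p - C t) with hs_def
  have hs : s ^ p = algebraMap K _ t := by
    have := AdjoinRoot.eval₂_root (X ^ p - C t)
    simpa [sub_eq_zero] using this
  have hsQ : aeval s Q = algebraMap K _ e := by
    apply frobenius_inj _ p
    rw [frobenius_def, frobenius_def, ← map_pow, ← map_pow, he, ← map_frobenius_expand p Q,
      map_expand, expand_aeval, hs, aeval_algebraMap_apply]
  have hder : derivative Q = 0 := by
    by_contra hne
    obtain ⟨H, hH⟩ : X ^ p - C t ∣ Q.map (algebraMap k K) - C e := by
      rw [← AdjoinRoot.mk_eq_zero, ← AdjoinRoot.aeval_eq, map_sub, aeval_map_algebraMap, aeval_C,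
        ← hs_def, hsQ, sub_self]
    have h1 := congrArg derivative hH
    simp only [derivative_sub, derivative_C, sub_zero, derivative_mul, derivative_X_pow,
      CharP.cast_eq_zero, map_zero, zero_mul, zero_add, derivative_map] at h1
    have h2 : aeval s (derivative Q) = 0 := by
      have h3 := congrArg (aeval s) h1
      rwa [aeval_map_algebraMap, map_mul, AdjoinRoot.aeval_eq (X ^ p - C t), AdjoinRoot.mk_self,
        zero_mul] at h3
    have h4 : IsAlgebraic k (s ^ p) := IsAlgebraic.pow ⟨_, hne, h2⟩ p
    rw [hs] at h4
    exact ht ((isAlgebraic_algebraMap_iff (algebraMap K (AdjoinRoot (X ^ p - C t))).injective).1 h4)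
  rw [← expand_contract p hder hp.ne_zero, expand_aeval, hs, aeval_algebraMap_apply] at hsQ
  rw [← (algebraMap K (AdjoinRoot (X ^ p - C t))).injective hsQ]
  exact hmem _

attribute [local instance] Polynomial.algebra in
theorem mem_adjoin_of_mem_adjoin_of_isAlgebraic {k K : Type*} [Field k] [Field K] [Algebra k K]
    [IsAlgClosed k] (E : IntermediateField k K) {t : K} (ht : Transcendental E t) {z : K}
    (hz : z ∈ adjoin E {t}) (hzt : IsAlgebraic (adjoin k {t}) z) : z ∈ adjoin k {t} := by
  have hinj : Function.Injective (aeval t : E[X] →ₐ[E] K) := transcendental_iff_injective.1 ht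
  let f : RatFunc E →ₐ[E] K := RatFunc.liftAlgHom (aeval t)
    (nonZeroDivisors_le_comap_nonZeroDivisors_of_injective _ hinj)
  have hf (P : E[X]) : f (algebraMap _ _ P) = aeval t P := by
    have := RatFunc.liftAlgHom_apply_div (φ := aeval t)
      (nonZeroDivisors_le_comap_nonZeroDivisors_of_injective _ hinj) P 1
    simpa using this
  have hmem (f : k[X]) : aeval t f ∈ adjoin k {t} :=
    algebra_adjoin_le_adjoin _ _ (aeval_mem_adjoin_singleton k t)
  have hfk (d : k[X]) : f (algebraMap k[X] (RatFunc E) d) = aeval t d := by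
    rw [IsScalarTower.algebraMap_apply k[X] E[X] (RatFunc E), hf, Polynomial.algebraMap_def,
      coe_mapRingHom, aeval_map_algebraMap]
  obtain ⟨r, rfl⟩ : ∃ r, f r = z := by
    obtain ⟨a, b, rfl⟩ := (mem_adjoin_simple_iff _ _).1 hz
    exact ⟨algebraMap _ _ a / algebraMap _ _ b, by rw [map_div₀, hf, hf]⟩
  have halg : IsAlgebraic k[X] r := by
    rw [← IsFractionRing.isAlgebraic_iff (Algebra.adjoin k {t}) (adjoin k {t}) K] at hzt
    let g : k[X] →ₐ[k] Algebra.adjoin k {t} := (aeval t).codRestrict (Algebra.adjoin k {t})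
      fun _ => aeval_mem_adjoin_singleton k t
    refine IsAlgebraic.of_ringHom_of_comp_eq g f hzt ?_ f.injective
      (RingHom.ext fun d => (hfk d).symm)
    rintro ⟨y, hy⟩
    rw [Algebra.adjoin_singleton_eq_range_aeval] at hy
    obtain ⟨d, rfl⟩ := hy
    exact ⟨d, rfl⟩
  obtain ⟨d, hd, hint⟩ := halg.exists_integral_multiple
  have := hint.tower_top (A := E[X])
  obtain ⟨P, hP⟩ := IsIntegrallyClosed.isIntegral_iff.1 this
  rw [← hP, isIntegral_algebraMap_iff (IsFractionRing.injective E[X] (RatFunc E))] at hint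
  obtain ⟨Q, rfl⟩ : ∃ Q : k[X], Q.map (algebraMap k E) = P := by
    refine (mem_lifts _).1 ((lifts_iff_coeff_lifts _).2 fun n => ?_)
    have hn := Polynomial.isIntegral_iff_isIntegral_coeff.1 hint n
    exact minpoly.mem_range_of_degree_eq_one _ _
      (IsAlgClosed.degree_eq_one_of_irreducible k (minpoly.irreducible hn))
  have hdt : aeval t d ≠ 0 := by
    intro h0
    refine hd (Polynomial.map_injective (algebraMap k E) (algebraMap k E).injective ?_)
    rw [Polynomial.map_zero]
    exact hinj (by rw [aeval_map_algebraMap, h0, map_zero])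
  have he := congrArg f hP
  rw [hf, aeval_map_algebraMap, Algebra.smul_def, map_mul, hfk] at he
  rw [eq_div_of_mul_eq hdt ((mul_comm _ _).trans he.symm)]
  exact div_mem (hmem Q) (hmem d)

theorem exists_pow_pow_eq_forall_pow_ne {k K : Type*} [Field k] [Field K] [Algebra k K]
    [Algebra.EssFiniteType k K] {x : K} (hx : Transcendental k x) {p : ℕ} (hp : 1 < p) :
    ∃ (n : ℕ) (y : K), y ^ p ^ n = x ∧ ∀ z : K, z ^ p ≠ y := by
  by_contra! H
  let T := {y : K // ∃ n : ℕ, y ^ p ^ n = x}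
  have hstep (y : T) : ∃ z : T, (z : K) ^ p = y := by
    obtain ⟨y, n, hy⟩ := y
    obtain ⟨z, hz⟩ := H n y hy
    exact ⟨⟨z, n + 1, by rw [pow_succ', pow_mul, hz, hy]⟩, hz⟩
  choose r hr using hstep
  let s (n : ℕ) : T := r^[n] ⟨x, 0, by simp⟩
  have hs (n : ℕ) : (s (n + 1) : K) ^ p = s n := by
    simp only [s, Function.iterate_succ_apply', hr]
  have : Algebra.EssFiniteType (adjoin k {x}) K := .of_comp k _ K
  have := finiteDimensional_algebraicClosure (adjoin k {x}) K
  let F (n : ℕ) : IntermediateField (adjoin k {x}) K := adjoin _ {(s n : K)}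
  have hF : Monotone F := monotone_nat_of_le_succ fun n => by
    rw [adjoin_simple_le_iff, ← hs]
    exact pow_mem (mem_adjoin_simple_self _ _) _
  let N : ℕ →o Submodule (adjoin k {x}) (algebraicClosure (adjoin k {x}) K) :=
    ⟨fun n => (F n).toSubalgebra.toSubmodule.comap
      (algebraicClosure (adjoin k {x}) K).val.toLinearMap, fun m n h y hy => hF h hy⟩
  obtain ⟨n, hn⟩ := monotone_stabilizes_iff_noetherian.2 inferInstance N
  have halg : (s (n + 1) : K) ∈ algebraicClosure (adjoin k {x}) K := by
    obtain ⟨m, hm⟩ := (s (n + 1)).2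
    refine mem_algebraicClosure_iff.2 (IsAlgebraic.of_pow (n := p ^ m) (by positivity) ?_)
    rw [hm]
    exact isAlgebraic_algebraMap (⟨x, mem_adjoin_simple_self k x⟩ : adjoin k {x})
  have hmem : (s (n + 1) : K) ∈ F n := by
    have h1 : (⟨_, halg⟩ : algebraicClosure (adjoin k {x}) K) ∈ N (n + 1) :=
      mem_adjoin_simple_self (adjoin k {x}) (s (n + 1) : K)
    rw [← hn (n + 1) n.le_succ] at h1
    exact h1
  have hmem' : (s (n + 1) : K) ∈ adjoin k {(s n : K)} := by
    have h1 : (F n).restrictScalars k ≤ adjoin k {(s n : K)} := by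
      rw [adjoin_adjoin_left, adjoin_le_iff, Set.union_subset_iff, Set.singleton_subset_iff,
        Set.singleton_subset_iff]
      obtain ⟨m, hm⟩ := (s n).2
      have := mem_adjoin_simple_self k (s n : K)
      have hx' := pow_mem this (p ^ m)
      rw [hm] at hx'
      exact ⟨hx', this⟩
    exact h1 hmem
  rw [← hs] at hmem'
  refine not_mem_adjoin_pow (fun h => hx ?_) hp hmem'
  obtain ⟨m, hm⟩ := (s (n + 1)).2
  exact hm ▸ h.pow _

theorem algebraicIndependent_pair_iff_two_le_eRk {k K : Type*} [Field k] [Field K] [Algebra k K]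
    {a b : K} : AlgebraicIndependent k ![a, b] ↔
      2 ≤ (AlgebraicIndependent.matroid k K).eRk {a, b} := by
  constructor
  · intro h
    have hab : a ≠ b := fun e => by
      have := h.injective (a₁ := 0) (a₂ := 1) (by simpa using e)
      simp at this
    have h1 : (AlgebraicIndependent.matroid k K).Indep {a, b} := by
      have := h.coe_range
      rw [Matrix.range_cons_cons_empty] at this
      exact this
    rw [h1.eRk_eq_encard, Set.encard_pair hab]
  · intro h
    have hab : a ≠ b := by
      rintro rfl
      have := h.trans (Matroid.eRk_le_encard _ _)
      norm_num [Set.pair_eq_singleton] at this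
    have h1 : AlgebraicIndepOn k id ({a, b} : Set K) := by
      refine (Matroid.IsRkFinite.indep_of_encard_le_eRk ?_ ?_ :
        (AlgebraicIndependent.matroid k K).Indep {a, b})
      · exact Matroid.isRkFinite_of_finite _ (Set.toFinite _)
      · rwa [Set.encard_pair hab]
    have h2 := h1.comp (fun i : Fin 2 => ⟨![a, b] i, by fin_cases i <;> simp⟩) (by
      intro i j hij
      fin_cases i <;> fin_cases j <;> simp_all [Ne.symm])
    exact h2

theorem AlgebraicIndependent.pair_swap {k K : Type*} [Field k] [Field K] [Algebra k K]
    {a b : K} (h : AlgebraicIndependent k ![a, b]) : AlgebraicIndependent k ![b, a] := by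
  rw [algebraicIndependent_pair_iff_two_le_eRk] at h ⊢
  rwa [Set.pair_comm]

theorem AlgebraicIndependent.pair_of_isAlgebraic {k K : Type*} [Field k] [Field K] [Algebra k K]
    {a b c d : K} (h : AlgebraicIndependent k ![a, b]) (ha : IsAlgebraic (adjoin k {c, d}) a)
    (hb : IsAlgebraic (adjoin k {c, d}) b) : AlgebraicIndependent k ![c, d] := by
  rw [algebraicIndependent_pair_iff_two_le_eRk] at h ⊢
  rw [← IsFractionRing.isAlgebraic_iff (Algebra.adjoin k {c, d})] at ha hb
  rw [← Matroid.eRk_closure_eq, AlgebraicIndependent.matroid_closure_eq]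
  refine h.trans (Matroid.eRk_mono _ ?_)
  rintro _ (rfl | rfl)
  exacts [ha, hb]

theorem algebraicIndependent_pair_iff_transcendental {k K : Type*} [Field k] [Field K]
    [Algebra k K] {a b : K} : AlgebraicIndependent k ![a, b] ↔
      Transcendental k a ∧ Transcendental (adjoin k {a}) b := by
  have := AlgebraicIndependent.iff_transcendental_adjoin_image (R := k) (x := ![a, b]) 1
  have h0 : ![a, b] '' {1}ᶜ = {a} := by
    rw [show ({1}ᶜ : Set (Fin 2)) = {0} by ext i; fin_cases i <;> simp]
    simp
  rw [h0] at this
  rw [this, Transcendental, Transcendental, Transcendental,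
    ← IsFractionRing.isAlgebraic_iff (Algebra.adjoin k {a}) (adjoin k {a})]
  refine and_congr_left' ?_
  have : Subsingleton {j : Fin 2 // j ≠ 1} := by
    have h01 : ∀ i j : Fin 2, i ≠ 1 → j ≠ 1 → i = j := by decide
    exact ⟨fun i j => Subtype.ext (h01 i j i.2 j.2)⟩
  exact algebraicIndependent_singleton_iff (⟨0, by simp⟩ : {j : Fin 2 // j ≠ 1})

theorem IsAlgebraic.of_intermediateField_le {k K : Type*} [Field k] [Field K] [Algebra k K]
    {E F : IntermediateField k K} (h : E ≤ F) {z : K} (hz : IsAlgebraic E z) :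
    IsAlgebraic F z := by
  let _ : Algebra E F := (inclusion h).toRingHom.toAlgebra
  have : IsScalarTower E F K := .of_algebraMap_eq fun _ => rfl
  exact hz.tower_top F

theorem mem_adjoin_of_pow_pow_mem_adjoin {k K : Type*} [Field k] [Field K] [Algebra k K]
    [IsAlgClosed k] {p : ℕ} [ExpChar K p] {t : K} (ht : Transcendental k t)
    (hts : IsSeparableIn K t) {w : K} {n : ℕ} (hw : w ^ p ^ n ∈ adjoin k {t}) :
    w ∈ adjoin k {t} := by
  rcases ‹ExpChar K p› with _ | hp
  · simpa using hw
  · induction n with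
    | zero => simpa using hw
    | succ n ih =>
      rw [pow_succ, pow_mul] at hw
      exact ih (mem_adjoin_of_pow_mem_adjoin hp ht (fun y hy => hts p hp ‹_› ⟨y, hy⟩) hw)

theorem exists_isSeparable_pow {M K : Type*} [Field M] [Field K] [Algebra M K] (p : ℕ)
    [ExpChar M p] {z : K} (hz : IsAlgebraic M z) : ∃ n : ℕ, IsSeparable M (z ^ p ^ n) := by
  obtain ⟨g, hg, n, hgn⟩ := (minpoly.irreducible hz.isIntegral).hasSeparableContraction p
  refine ⟨n, hg.of_dvd (minpoly.dvd _ _ ?_)⟩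
  rw [← expand_aeval, hgn, minpoly.aeval]

theorem finite_intermediateField_separableClosure (M K : Type*) [Field M] [Field K] [Algebra M K]
    [Algebra.EssFiniteType M K] : Finite (IntermediateField M (separableClosure M K)) := by
  have := finiteDimensional_algebraicClosure M K
  have h : separableClosure M K ≤ algebraicClosure M K := fun x hx =>
    mem_algebraicClosure_iff.2 (mem_separableClosure_iff.1 hx).isIntegral.isAlgebraic
  have : FiniteDimensional M (separableClosure M K) :=
    FiniteDimensional.of_injective (inclusion h).toLinearMap (inclusion h).injective
  exact Field.finite_intermediateField_of_exists_primitive_element _ _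
    (Field.exists_primitive_element _ _)

theorem exists_isGeneralElement_add_mul {k K : Type*} [Field k] [Field K] [Algebra k K]
    [IsAlgClosed k] [Algebra.EssFiniteType k K] {u v : K} (huv : AlgebraicIndependent k ![u, v])
    (hsep : IsSeparableIn K u ∨ IsSeparableIn K v) :
    ∃ c : k, IsGeneralElement k (u + algebraMap k K c * v) := by
  let t (c : k) : K := u + algebraMap k K c * v
  let M : IntermediateField k K := adjoin k {u, v}
  have hu : u ∈ M := subset_adjoin _ _ (by simp)
  have hv : v ∈ M := subset_adjoin _ _ (by simp)
  have ht (c : k) : t c ∈ M := add_mem hu (mul_mem (IntermediateField.algebraMap_mem _ _) hv)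
  have hsub {c c' : k} (h : c ≠ c') : algebraMap k K (c - c') ≠ 0 := by
    simpa [sub_eq_zero] using h
  have hvt {c c' : k} (h : c ≠ c') : v = (t c - t c') / algebraMap k K (c - c') := by
    rw [eq_div_iff (hsub h), map_sub]
    simp only [t]
    ring
  have hut (c : k) : u = t c - algebraMap k K c * v := by simp [t]
  have hind {c c' : k} (h : c ≠ c') : AlgebraicIndependent k ![t c, t c'] := by
    have h1 : t c ∈ adjoin k {t c, t c'} := subset_adjoin _ _ (by simp)
    have h2 : t c' ∈ adjoin k {t c, t c'} := subset_adjoin _ _ (by simp)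
    have h3 : v ∈ adjoin k {t c, t c'} := by
      rw [hvt h]
      exact div_mem (sub_mem h1 h2) (IntermediateField.algebraMap_mem _ _)
    have h4 : u ∈ adjoin k {t c, t c'} := by
      rw [hut c]
      exact sub_mem h1 (mul_mem (IntermediateField.algebraMap_mem _ _) h3)
    exact huv.pair_of_isAlgebraic (isAlgebraic_algebraMap (⟨u, h4⟩ : adjoin k {t c, t c'}))
      (isAlgebraic_algebraMap (⟨v, h3⟩ : adjoin k {t c, t c'}))
  have : Algebra.EssFiniteType M K := .of_comp k _ K
  have := finite_intermediateField_separableClosure M K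
  let E (c : k) : IntermediateField k K :=
    (algebraicClosure (adjoin k {t c}) K).restrictScalars k
  have htE (c : k) : t c ∈ E c := mem_algebraicClosure_iff.2
    (isAlgebraic_algebraMap (⟨_, mem_adjoin_simple_self k (t c)⟩ : adjoin k {t c}))
  let D (c : k) : Set K := {z | z ∈ E c ∧ z ∈ separableClosure M K}
  have hG (c : k) : adjoin M (D c) ≤ separableClosure M K := adjoin_le_iff.2 fun z hz => hz.2
  obtain ⟨Γ, hΓ⟩ := Finite.exists_infinite_fiber fun c => restrict (hG c)
  rw [Set.infinite_coe_iff] at hΓ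
  have hΓG {c c' : k} (hc : c ∈ (fun c => restrict (hG c)) ⁻¹' {Γ})
      (hc' : c' ∈ (fun c => restrict (hG c)) ⁻¹' {Γ}) : adjoin M (D c) = adjoin M (D c') := by
    rw [← lift_restrict (hG c), ← lift_restrict (hG c')]
    exact congrArg lift ((hc : _ = Γ).trans (hc' : _ = Γ).symm)
  have hins : {c : k | ¬ IsSeparableIn K (t c)}.Subsingleton := by
    intro c hc c' hc'
    by_contra hne
    simp only [IsSeparableIn, Set.mem_ofPred_eq, not_forall, not_not] at hc hc'
    obtain ⟨p, hp, hpK, y, hy⟩ := hc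
    obtain ⟨p', hp', hpK', y', hy'⟩ := hc'
    obtain rfl := CharP.eq K hpK hpK'
    have : Fact p.Prime := ⟨hp⟩
    have hk (a : k) : ∃ b : k, b ^ p = a := IsAlgClosed.exists_pow_nat_eq a hp.pos
    obtain ⟨b, hb⟩ := hk (c - c')
    obtain ⟨d, hd⟩ := hk c
    have hvp : ((y - y') / algebraMap k K b) ^ p = v := by
      rw [div_pow, sub_pow_char, hy, hy', ← map_pow, hb, ← hvt hne]
    have hup : (y - algebraMap k K d * ((y - y') / algebraMap k K b)) ^ p = u := by
      rw [sub_pow_char, mul_pow, hvp, hy, ← map_pow, hd, ← hut]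
    exact hsep.elim (fun h => h p hp hpK ⟨_, hup⟩) (fun h => h p hp hpK ⟨_, hvp⟩)
  obtain ⟨c, hc, hcs⟩ := (hΓ.sdiff hins.finite).nonempty
  rw [Set.mem_ofPred_eq, not_not] at hcs
  obtain ⟨c', hc', hcc'⟩ := (hΓ.sdiff (Set.finite_singleton c)).nonempty
  have hne : c' ≠ c := hcc'
  obtain ⟨-, htt⟩ := algebraicIndependent_pair_iff_transcendental.1 (hind hne)
  obtain ⟨htc, -⟩ := algebraicIndependent_pair_iff_transcendental.1 (hind hne.symm)
  have hD {z : K} (hz : z ∈ D c) : z ∈ adjoin k {t c} := by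
    refine mem_adjoin_of_mem_adjoin_of_isAlgebraic (E c') (t := t c) ?_ ?_
      (mem_algebraicClosure_iff.1 hz.1)
    · intro h
      have h' : IsAlgebraic (algebraicClosure (adjoin k {t c'}) K) (t c) := h
      exact htt (h'.restrictScalars _)
    · have hzG : z ∈ adjoin M (D c') := hΓG hc hc' ▸ subset_adjoin M (D c) hz
      suffices h : (adjoin M (D c')).restrictScalars k ≤ (adjoin (E c') {t c}).restrictScalars k from
        h hzG
      have h0 {w : K} (hw : w ∈ E c') : w ∈ adjoin (E c') {t c} :=
        IntermediateField.algebraMap_mem _ (⟨w, hw⟩ : E c')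
      have hk (a : k) : algebraMap k K a ∈ adjoin (E c') {t c} :=
        h0 (IntermediateField.algebraMap_mem _ a)
      have h1 : t c ∈ adjoin (E c') {t c} := mem_adjoin_simple_self _ _
      have h3 : v ∈ adjoin (E c') {t c} := by
        rw [hvt hne.symm]
        exact div_mem (sub_mem h1 (h0 (htE c'))) (hk _)
      have h4 : u ∈ adjoin (E c') {t c} := by
        rw [hut c]
        exact sub_mem h1 (mul_mem (hk _) h3)
      rw [adjoin_adjoin_left, adjoin_le_iff, Set.union_subset_iff, Set.insert_subset_iff,
        Set.singleton_subset_iff]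
      exact ⟨⟨h4, h3⟩, fun w hw => h0 hw.1⟩
  refine ⟨c, fun h => ?_, fun z hz => ?_⟩
  · obtain ⟨a, ha⟩ := mem_bot.1 h
    exact htc (show IsAlgebraic k (u + _) from ha ▸ isAlgebraic_algebraMap a)
  · obtain ⟨p, hp⟩ := ExpChar.exists K
    have : ExpChar M p := (algebraMap M K).expChar (algebraMap M K).injective p
    have hzM : IsAlgebraic M z :=
      hz.of_intermediateField_le (adjoin_simple_le_iff.2 (ht c))
    obtain ⟨n, hn⟩ := exists_isSeparable_pow p hzM
    refine mem_adjoin_of_pow_pow_mem_adjoin (p := p) (n := n) htc hcs (hD ⟨?_, ?_⟩)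
    · exact mem_algebraicClosure_iff.2 (hz.pow _)
    · exact mem_separableClosure_iff.2 hn

theorem transcendental_of_not_mem_bot {k K : Type*} [Field k] [Field K] [Algebra k K]
    [IsAlgClosed k] {x : K} (hx : x ∉ (⊥ : IntermediateField k K)) : Transcendental k x := fun h =>
  hx <| mem_bot.2 <| minpoly.mem_range_of_degree_eq_one _ _
    (IsAlgClosed.degree_eq_one_of_irreducible k (minpoly.irreducible h.isIntegral))

theorem IsGeneralElement.of_adjoin_eq {k K : Type*} [Field k] [Field K] [Algebra k K] {s t : K}
    (hs : IsGeneralElement k s) (hst : adjoin k {t} = adjoin k {s}) : IsGeneralElement k t := by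
  refine ⟨fun ht => hs.1 ?_, hst ▸ hs.2⟩
  have := mem_adjoin_simple_self k s
  rwa [← hst, adjoin_simple_eq_bot_iff.2 ht] at this

theorem IsGeneralElement.inv {k K : Type*} [Field k] [Field K] [Algebra k K] {s : K}
    (hs : IsGeneralElement k s) : IsGeneralElement k s⁻¹ := by
  refine hs.of_adjoin_eq (le_antisymm ?_ ?_) <;> rw [adjoin_simple_le_iff]
  · exact inv_mem (mem_adjoin_simple_self _ _)
  · rw [← inv_mem_iff]
    exact mem_adjoin_simple_self _ _

theorem IsGeneralElement.algebraMap_mul {k K : Type*} [Field k] [Field K] [Algebra k K] {s : K}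
    (hs : IsGeneralElement k s) {c : k} (hc : c ≠ 0) :
    IsGeneralElement k (algebraMap k K c * s) := by
  have hc' : algebraMap k K c ≠ 0 := by simpa using hc
  refine hs.of_adjoin_eq (le_antisymm ?_ ?_) <;> rw [adjoin_simple_le_iff]
  · exact mul_mem (IntermediateField.algebraMap_mem _ _) (mem_adjoin_simple_self _ _)
  · have := div_mem (mem_adjoin_simple_self k (algebraMap k K c * s))
      (IntermediateField.algebraMap_mem (adjoin k {algebraMap k K c * s}) c)
    rwa [mul_div_cancel_left₀ _ hc'] at this

theorem IsGeneralElement.add_algebraMap {k K : Type*} [Field k] [Field K] [Algebra k K] {s : K}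
    (hs : IsGeneralElement k s) (c : k) : IsGeneralElement k (s + algebraMap k K c) := by
  refine hs.of_adjoin_eq (le_antisymm ?_ ?_) <;> rw [adjoin_simple_le_iff]
  · exact add_mem (mem_adjoin_simple_self _ _) (IntermediateField.algebraMap_mem _ _)
  · have := sub_mem (mem_adjoin_simple_self k (s + algebraMap k K c))
      (IntermediateField.algebraMap_mem (adjoin k {s + algebraMap k K c}) c)
    rwa [add_sub_cancel_right] at this

theorem IsGeneralElement.isSeparableIn {k K : Type*} [Field k] [Field K] [Algebra k K]
    [IsAlgClosed k] {s : K} (hs : IsGeneralElement k s) : IsSeparableIn K s := by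
  rintro p hp - ⟨z, rfl⟩
  refine not_mem_adjoin_pow (fun hz => transcendental_of_not_mem_bot hs.1 (hz.pow p)) hp.one_lt
    (hs.2 z (IsAlgebraic.of_pow hp.pos ?_))
  exact isAlgebraic_algebraMap (⟨_, mem_adjoin_simple_self k (z ^ p)⟩ : adjoin k {z ^ p})

theorem exists_isSeparableIn_pow_eq {k K : Type*} [Field k] [Field K] [Algebra k K]
    [Algebra.EssFiniteType k K] {x : K} (hx : Transcendental k x) :
    ∃ (n : ℕ) (y : K), 0 < n ∧ y ^ n = x ∧ IsSeparableIn K y := by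
  obtain ⟨p, hpK⟩ := CharP.exists K
  by_cases hp : p.Prime
  · obtain ⟨n, y, hy, hy'⟩ := exists_pow_pow_eq_forall_pow_ne hx hp.one_lt
    refine ⟨p ^ n, y, pow_pos hp.pos n, hy, ?_⟩
    rintro q - hqK ⟨z, hz⟩
    obtain rfl := CharP.eq K hpK hqK
    exact hy' z hz
  · exact ⟨1, x, one_pos, pow_one x, fun q hq hqK => (hp (CharP.eq K hqK hpK ▸ hq)).elim⟩

theorem exists_isGeneralElement_algebraicIndependent {k K : Type*} [Field k] [Field K]
    [Algebra k K] [IsAlgClosed k] [Algebra.EssFiniteType k K] {L : IntermediateField k K}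
    (hL : RelAlgClosed L) (htr : TrdegGe k L 2) {x : K} (hx : Transcendental k x) (hxL : x ∈ L) :
    ∃ y ∈ L, IsGeneralElement k y ∧ AlgebraicIndependent k ![x, y] := by
  obtain ⟨z, hzL, hxz⟩ : ∃ z ∈ L, AlgebraicIndependent k ![x, z] := by
    by_contra! H
    have halg (z : L) : IsAlgebraic (adjoin k {x, x}) (z : K) := by
      by_contra hz
      rw [Set.pair_eq_singleton] at hz
      exact H z z.2 (algebraicIndependent_pair_iff_transcendental.2 ⟨hx, hz⟩)
    obtain ⟨w, hw⟩ := htr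
    have hw' : AlgebraicIndependent k ![(w 0 : K), w 1] := by
      convert hw.map' (f := L.val) L.val.injective using 1
      ext i
      fin_cases i <;> rfl
    have := (hw'.pair_of_isAlgebraic (halg _) (halg _)).injective.ne (a₁ := 0) (a₂ := 1) (by simp)
    exact this rfl
  obtain ⟨n, x₁, hn, rfl, hsep⟩ := exists_isSeparableIn_pow_eq hx
  have hx₁L : x₁ ∈ L :=
    hL _ (IsAlgebraic.of_pow hn (isAlgebraic_algebraMap (⟨_, hxL⟩ : L)))
  have hself {a b c : K} (h : c ∈ adjoin k {a, b}) : IsAlgebraic (adjoin k {a, b}) c :=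
    isAlgebraic_algebraMap (⟨c, h⟩ : adjoin k {a, b})
  have hl (a b : K) : a ∈ adjoin k {a, b} := subset_adjoin _ _ (by simp)
  have hr (a b : K) : b ∈ adjoin k {a, b} := subset_adjoin _ _ (by simp)
  have hzx₁ : AlgebraicIndependent k ![z, x₁] :=
    hxz.pair_of_isAlgebraic (hself (pow_mem (hr _ _) n)) (hself (hl _ _))
  obtain ⟨c, hc⟩ := exists_isGeneralElement_add_mul hzx₁ (.inr hsep)
  refine ⟨_, add_mem hzL (mul_mem (IntermediateField.algebraMap_mem L c) hx₁L), hc, ?_⟩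
  set y := z + algebraMap k K c * x₁ with hy
  have hyx₁ : AlgebraicIndependent k ![x₁, y] := by
    refine hzx₁.pair_of_isAlgebraic (hself ?_) (hself (hl _ _))
    rw [← sub_eq_iff_eq_add.2 hy]
    exact sub_mem (hr _ _) (mul_mem (IntermediateField.algebraMap_mem _ _) (hl _ _))
  exact hyx₁.pair_of_isAlgebraic (IsAlgebraic.of_pow hn (hself (hl _ _))) (hself (hr _ _))

end

theorem statement_8 (k K : Type*) [Field k] [Field K] [Algebra k K]
    [IsAlgClosed k] (hK : IsFunctionField k K)
    (L : IntermediateField k K) (hL : RelAlgClosed L) (htr : TrdegGe k L 2) :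
    ∀ x : K, x ∈ L → x ≠ 0 →
      ∃ s t : K, s ∈ L ∧ t ∈ L ∧ IsGeneralElement k s ∧ IsGeneralElement k t ∧ x = s * t := by
  intro x hxL hx0
  have : Algebra.EssFiniteType k K := by
    obtain ⟨s, hs⟩ := hK
    exact IntermediateField.fg_top_iff.1 ⟨s, hs⟩
  by_cases hx : x ∈ (⊥ : IntermediateField k K)
  · obtain ⟨c, rfl⟩ := IntermediateField.mem_bot.1 hx
    have hc : c ≠ 0 := by rintro rfl; simp at hx0
    obtain ⟨w, hw⟩ := htr
    have hw0 : Transcendental k (w 0 : K) :=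
      (transcendental_algebraMap_iff (algebraMap L K).injective).2 (hw.transcendental 0)
    obtain ⟨y, hyL, hy, -⟩ :=
      exists_isGeneralElement_algebraicIndependent hL ⟨w, hw⟩ hw0 (w 0).2
    have hy0 : y ≠ 0 := by
      rintro rfl
      exact hy.1 (zero_mem _)
    exact ⟨_, y, mul_mem hxL (inv_mem hyL), hyL, hy.inv.algebraMap_mul hc, hy, by
      rw [inv_mul_cancel_right₀ hy0]⟩
  · obtain ⟨y, hyL, hy, hxy⟩ := exists_isGeneralElement_algebraicIndependent hL htr
      (transcendental_of_not_mem_bot hx) hxL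
    have huv : AlgebraicIndependent k ![y / x, x⁻¹] := by
      have hv : x⁻¹ ∈ IntermediateField.adjoin k {y / x, x⁻¹} :=
        IntermediateField.subset_adjoin _ _ (by simp)
      have hu : y / x ∈ IntermediateField.adjoin k {y / x, x⁻¹} :=
        IntermediateField.subset_adjoin _ _ (by simp)
      have hx' : x ∈ IntermediateField.adjoin k {y / x, x⁻¹} := inv_mem_iff.1 hv
      have hy' : y ∈ IntermediateField.adjoin k {y / x, x⁻¹} := by
        simpa [hx0] using mul_mem hu hx'
      exact hxy.pair_of_isAlgebraic
        (isAlgebraic_algebraMap (⟨x, hx'⟩ : IntermediateField.adjoin k {y / x, x⁻¹}))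
        (isAlgebraic_algebraMap (⟨y, hy'⟩ : IntermediateField.adjoin k {y / x, x⁻¹}))
    have hsep : IsSeparableIn K (y / x) ∨ IsSeparableIn K x⁻¹ := by
      by_contra! H
      simp only [IsSeparableIn, not_forall, not_not] at H
      obtain ⟨⟨p, hp, hpK, a, ha⟩, q, hq, hqK, b, hb⟩ := H
      obtain rfl := CharP.eq K hpK hqK
      exact hy.isSeparableIn p hp hpK ⟨a / b, by rw [div_pow, ha, hb]; field_simp⟩
    obtain ⟨c, hc⟩ := exists_isGeneralElement_add_mul huv hsep
    have hw : y / x + algebraMap k K c * x⁻¹ = (y + algebraMap k K c) / x := by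
      rw [add_div, div_eq_mul_inv (algebraMap k K c)]
    rw [hw] at hc
    have hs := hy.add_algebraMap c
    have hs0 : y + algebraMap k K c ≠ 0 := fun h => hs.1 (h ▸ zero_mem _)
    have hsL : y + algebraMap k K c ∈ L := add_mem hyL (L.algebraMap_mem c)
    exact ⟨_, _, hsL, inv_mem (div_mem hsL hxL), hs, hc.inv, by rw [inv_div, mul_div_cancel₀ _ hs0]⟩

end
end
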